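/- For d ≥ 105 and n ≥ d+2, q_d^{(1)}(n) ≥ Q_{d−4}^{(1,−)}(n). -/

import Mathlib

/-- `rho A n` is the number of partitions of `n` all of whose parts lie in `A`. -/
noncomputable def rho (A : Set ℕ) (n : ℕ) : ℕ :=
  Nat.card {p : n.Partition // ∀ x ∈ p.parts, x ∈ A}

/-- `qpart a d n` is the number of partitions of `n` into parts that are all `≥ a`
and pairwise differ by at least `d` (so, in particular, are distinct when `d ≥ 1`). -/
noncomputable def qpart (a d n : ℕ) : ℕ :=
  Nat.card {p : n.Partition //
    (∀ x ∈ p.parts, a ≤ x) ∧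
    (∀ x ∈ p.parts, p.parts.count x ≤ 1) ∧
    (∀ x ∈ p.parts, ∀ y ∈ p.parts, x ≠ y → d ≤ max x y - min x y)}

/-- Positive integers congruent to `±a` modulo `m`, excluding `m - a`. -/
noncomputable def QminusSet (a m : ℕ) : Set ℕ :=
  {x | x % m = a % m ∨ x % m = (m - a) % m} \ {m - a}

/-- `Qminus a d n` counts partitions of `n` into parts `≡ ±a (mod d+3)`,
excluding the part `d+3-a`. -/
noncomputable def Qminus (a d n : ℕ) : ℕ := rho (QminusSet a (d + 3)) n

/-- `Qmm a d n` counts partitions of `n` into parts `≡ ±a (mod d+3)`,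
excluding both the parts `a` and `d+3-a`. -/
noncomputable def Qmm (a d n : ℕ) : ℕ := rho (QminusSet a (d + 3) \ {a}) n

/-- `Tset s d` is the set of naturals congruent to `1` or to `d + 2^j` for some
`1 ≤ j ≤ s - 1` modulo `2d`. -/
def Tset (s d : ℕ) : Set ℕ :=
  {y | y % (2 * d) = 1 % (2 * d) ∨
    ∃ j, 1 ≤ j ∧ j + 1 ≤ s ∧ y % (2 * d) = (d + 2 ^ j) % (2 * d)}

/-- `T5 d` : naturals congruent to `1, d+2, d+4, d+8` or `d+16` modulo `2d`. -/
def T5 (d : ℕ) : Set ℕ := Tset 5 d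

/-- `Sset d N` : naturals congruent to `±1` modulo `d-N+3`, excluding `d-N+2`. -/
def Sset (d N : ℕ) : Set ℕ :=
  {x | x % (d - N + 3) = 1 % (d - N + 3) ∨ x % (d - N + 3) = (d - N + 2) % (d - N + 3)}
    \ {d - N + 2}

/-- `xN d N i` is the `i`-th smallest element of `Sset d N` (1-indexed). -/
noncomputable def xN (d N i : ℕ) : ℕ := Nat.nth (· ∈ Sset d N) (i - 1)

/-- `yT d i` is the `i`-th smallest element of `T5 d` (1-indexed). -/
noncomputable def yT (d i : ℕ) : ℕ := Nat.nth (· ∈ T5 d) (i - 1)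

/-- Removing one copy of a part `x`: a partition with parts in `insert x A` either avoids `x` or
arises from a partition of `n - x`. -/
theorem rho_insert_le (A : Set ℕ) {x : ℕ} (hx : 0 < x) (n : ℕ) :
    rho (insert x A) n ≤ rho A n + if x ≤ n then rho (insert x A) (n - x) else 0 := by
  classical
  unfold rho
  split_ifs with hxn
  · rw [← Nat.card_sum]
    let f : {p : n.Partition // ∀ y ∈ p.parts, y ∈ insert x A} →
        {p : n.Partition // ∀ y ∈ p.parts, y ∈ A} ⊕
          {p : (n - x).Partition // ∀ y ∈ p.parts, y ∈ insert x A} := fun p =>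
      if h : x ∈ p.1.parts then
        Sum.inr ⟨⟨p.1.parts.erase x, fun hi => p.1.parts_pos (Multiset.mem_of_mem_erase hi), by
          have h1 := Multiset.sum_erase h
          have h2 := p.1.parts_sum
          omega⟩, fun y hy => p.2 y (Multiset.mem_of_mem_erase hy)⟩
      else Sum.inl ⟨p.1, fun y hy =>
        (Set.mem_insert_iff.1 (p.2 y hy)).resolve_left (fun e => h (e ▸ hy))⟩
    refine Nat.card_le_card_of_injective f fun p q hpq => ?_
    by_cases hp : x ∈ p.1.parts <;> by_cases hq : x ∈ q.1.parts <;>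
      simp only [f, hp, hq, dite_true, dite_false, Sum.inr.injEq, Sum.inl.injEq, Subtype.mk.injEq,
        Nat.Partition.mk.injEq, reduceCtorEq] at hpq
    · apply Subtype.ext
      apply Nat.Partition.ext
      rw [← Multiset.cons_erase hp, ← Multiset.cons_erase hq, hpq]
    · exact Subtype.ext hpq
  · refine Nat.card_le_card_of_injective
      (fun p => ⟨p.1, fun y hy => (Set.mem_insert_iff.1 (p.2 y hy)).resolve_left ?_⟩) ?_
    · rintro rfl
      exact hxn (Nat.Partition.le_of_mem_parts hy)
    · intro p q hpq
      simpa only [Subtype.mk.injEq, ← Subtype.ext_iff] using hpq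

theorem rho_mono {A B : Set ℕ} {n : ℕ} (h : ∀ x ∈ A, x ≤ n → x ∈ B) : rho A n ≤ rho B n := by
  refine Nat.card_le_card_of_injective
    (fun p => ⟨p.1, fun y hy => h y (p.2 y hy) (Nat.Partition.le_of_mem_parts hy)⟩) ?_
  intro p q hpq
  simpa only [Subtype.mk.injEq, ← Subtype.ext_iff] using hpq

theorem rho_singleton_one_le (n : ℕ) : rho {1} n ≤ 1 := by
  unfold rho
  have : Subsingleton {p : n.Partition // ∀ x ∈ p.parts, x ∈ ({1} : Set ℕ)} := by
    refine ⟨fun p q => Subtype.ext (Nat.Partition.ext ?_)⟩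
    have key : ∀ r : {p : n.Partition // ∀ x ∈ p.parts, x ∈ ({1} : Set ℕ)},
        r.1.parts = Multiset.replicate n 1 := by
      intro r
      have h := Multiset.eq_replicate_card.2 r.2
      have hs := r.1.parts_sum
      rw [h, Multiset.sum_replicate, smul_eq_mul, mul_one] at hs
      rw [h, hs]
    rw [key p, key q]
  exact Finite.card_le_one_iff_subsingleton.2 this

/-- `WeightBound c y A W` bounds the partitions with parts in `A` by `W * y ^ (-K)`, where
`K = ⌊2 n / c⌋`. -/
def WeightBound (c : ℕ) (y : ℝ) (A : Set ℕ) (W : ℝ) : Prop :=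
  ∀ K n : ℕ, 2 * n < c * (K + 1) → (rho A n : ℝ) * y ^ K ≤ W

theorem weightBound_singleton_one (c : ℕ) {y : ℝ} (h0 : 0 < y) (h1 : y < 1) :
    WeightBound c y {1} 1 := by
  intro K n _
  have h : (rho {1} n : ℝ) ≤ 1 := by exact_mod_cast rho_singleton_one_le n
  exact mul_le_one₀ h (by positivity) (pow_le_one₀ h0.le h1.le)

theorem WeightBound.insert {c : ℕ} {y : ℝ} {A : Set ℕ} {W : ℝ} (h0 : 0 < y) (h1 : y < 1)
    (h : WeightBound c y A W) {x w : ℕ} (hw : w ≠ 0) (hx : 0 < x) (hcx : c * w ≤ 2 * x) :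
    WeightBound c y (insert x A) (W / (1 - y ^ w)) := by
  intro K n
  have hyw : y ^ w < 1 := pow_lt_one₀ h0.le h1 hw
  have hpos : 0 < 1 - y ^ w := by linarith
  induction n using Nat.strong_induction_on generalizing K with
  | _ n ih =>
    intro hn
    have hrec : (rho (Insert.insert x A) n : ℝ) ≤
        rho A n + if x ≤ n then (rho (Insert.insert x A) (n - x) : ℝ) else 0 := by
      have := rho_insert_le A hx n
      split_ifs at this ⊢ <;> exact_mod_cast this
    have hA := h K n hn
    have hW : 0 ≤ W := le_trans (by positivity) hA
    rw [le_div_iff₀ hpos]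
    have hyK : 0 < y ^ K := by positivity
    split_ifs at hrec with hxn
    · have hwK : w ≤ K := by
        by_contra hlt
        have : c * (K + 1) ≤ c * w := Nat.mul_le_mul_left c (by omega)
        omega
      obtain ⟨k, rfl⟩ := Nat.exists_eq_add_of_le hwK
      have hI := ih (n - x) (by omega) k (by
        have : c * (w + k + 1) = c * w + c * (k + 1) := by ring
        omega)
      rw [le_div_iff₀ hpos] at hI
      have hyw0 : 0 < y ^ w := by positivity
      have e : y ^ (w + k) = y ^ w * y ^ k := pow_add y w k
      have h2 := mul_le_mul_of_nonneg_right hrec (mul_pos hyK hpos).le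
      have h3 := mul_le_mul_of_nonneg_right hA hpos.le
      have h4 := mul_le_mul_of_nonneg_right hI hyw0.le
      rw [e] at h2 h3 ⊢
      nlinarith
    · have h2 := mul_le_mul_of_nonneg_right hrec (mul_pos hyK hpos).le
      have h3 := mul_le_mul_of_nonneg_right hA hpos.le
      have hyw0 : 0 < y ^ w := by positivity
      nlinarith

/-- The parts `1`, `m + 1`, and `l * m ± 1` for `2 ≤ l ≤ L + 1`. -/
def pmParts (m : ℕ) : ℕ → Set ℕ
  | 0 => insert (m + 1) {1}
  | L + 1 => insert ((L + 2) * m + 1) (insert ((L + 2) * m - 1) (pmParts m L))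

theorem mem_pmParts_add {m L l : ℕ} (hl : l ≤ L + 1) : l * m + 1 ∈ pmParts m L := by
  induction L with
  | zero =>
    obtain rfl | rfl : l = 0 ∨ l = 1 := by omega
    all_goals simp [pmParts]
  | succ L ih =>
    rcases Nat.lt_or_ge l (L + 2) with h | h
    · exact Set.mem_insert_of_mem _ (Set.mem_insert_of_mem _ (ih (by omega)))
    · obtain rfl : l = L + 2 := by omega
      exact Set.mem_insert _ _

theorem mem_pmParts_sub {m L l : ℕ} (h2 : 2 ≤ l) (hl : l ≤ L + 1) :
    l * m - 1 ∈ pmParts m L := by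
  induction L with
  | zero => omega
  | succ L ih =>
    rcases Nat.lt_or_ge l (L + 2) with h | h
    · exact Set.mem_insert_of_mem _ (Set.mem_insert_of_mem _ (ih (by omega)))
    · obtain rfl : l = L + 2 := by omega
      exact Set.mem_insert_of_mem _ (Set.mem_insert _ _)

theorem mem_pmParts_of_mem_QminusSet {m x L : ℕ} (hm : 2 ≤ m) (hx : x ∈ QminusSet 1 m)
    (hxL : x < (L + 2) * m - 1) : x ∈ pmParts m L := by
  obtain ⟨hx1, hx2⟩ := hx
  have hdiv := Nat.div_add_mod' x m
  have e1 : 1 % m = 1 := Nat.mod_eq_of_lt hm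
  have e2 : (m - 1) % m = m - 1 := Nat.mod_eq_of_lt (by omega)
  rcases hx1 with h | h
  · rw [h, e1] at hdiv
    rw [← hdiv]
    refine mem_pmParts_add ?_
    by_contra hlt
    have := Nat.mul_le_mul_right m (show L + 2 ≤ x / m by omega)
    omega
  · rw [h, e2] at hdiv
    have e3 : (x / m + 1) * m - 1 = x := by
      rw [add_mul, one_mul]
      omega
    rw [← e3]
    refine mem_pmParts_sub ?_ ?_
    · by_contra hlt
      have h0 : x / m = 0 := Nat.le_antisymm (by omega) (Nat.zero_le _)
      rw [h0] at e3
      exact hx2 (by simp only [Set.mem_singleton_iff]; omega)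
    · by_contra hlt
      have := Nat.mul_le_mul_right m (show L + 2 ≤ x / m + 1 by omega)
      omega

theorem weightBound_pmParts {m : ℕ} (hm : 2 ≤ m) {y : ℝ} (h0 : 0 < y) (h1 : y < 1) (L : ℕ) :
    WeightBound (2 * m - 1) y (pmParts m L)
      ((1 - y) * (∏ l ∈ Finset.range (L + 1), (1 - y ^ (l + 1))⁻¹) ^ 2) := by
  induction L with
  | zero =>
    have h := (weightBound_singleton_one (2 * m - 1) h0 h1).insert h0 h1 (x := m + 1)
      one_ne_zero (by omega) (by omega)
    convert h using 1
    · rfl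
    · have : 1 - y ≠ 0 := by linarith
      rw [Finset.prod_range_one, zero_add, pow_one]
      field_simp
  | succ L ih =>
    have hc : (2 * m - 1) * (L + 2) + (L + 2) = 2 * ((L + 2) * m) := by
      obtain ⟨k, rfl⟩ := Nat.exists_eq_add_of_le hm
      have : 2 * (2 + k) - 1 = 2 * k + 3 := by omega
      rw [this]; ring
    have h := (ih.insert h0 h1 (x := (L + 2) * m - 1) (w := L + 2) (by omega) (by
      have : 2 * m ≤ (L + 2) * m := Nat.mul_le_mul_right m (by omega)
      omega) (by omega)).insert h0 h1
      (x := (L + 2) * m + 1) (w := L + 2) (by omega) (by omega) (by omega)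
    convert h using 1
    · rfl
    · rw [Finset.prod_range_succ _ (L + 1), mul_pow, div_div, div_eq_mul_inv, mul_assoc,
        ← pow_two, inv_pow]

/-- The Euler product estimate `∏ (1 - y ^ l)⁻¹ ≤ exp (ζ(2) y / (1 - y))`. -/
theorem prod_inv_one_sub_pow_le {y : ℝ} (h0 : 0 < y) (h1 : y < 1) (L : ℕ) :
    ∏ l ∈ Finset.range L, (1 - y ^ (l + 1))⁻¹ ≤
      Real.exp (Real.pi ^ 2 / 6 * (y / (1 - y))) := by
  have hlt : ∀ l : ℕ, y ^ (l + 1) < 1 := fun l => pow_lt_one₀ h0.le h1 (by omega)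
  have hpos : ∀ l ∈ Finset.range L, 0 < (1 - y ^ (l + 1))⁻¹ := fun l _ =>
    inv_pos.2 (by linarith [hlt l])
  rw [← Real.log_le_iff_le_exp (Finset.prod_pos hpos),
    Real.log_prod (fun l hl => (hpos l hl).ne')]
  have hs : HasSum (fun r : ℕ => ∑ l ∈ Finset.range L, (y ^ (l + 1)) ^ (r + 1) / ((r : ℝ) + 1))
      (∑ l ∈ Finset.range L, Real.log (1 - y ^ (l + 1))⁻¹) := by
    refine hasSum_sum fun l _ => ?_
    rw [Real.log_inv]
    refine Real.hasSum_pow_div_log_of_abs_lt_one ?_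
    rw [abs_of_pos (by positivity)]
    exact hlt l
  have hz : HasSum (fun r : ℕ => 1 / ((r : ℝ) + 1) ^ 2 * (y / (1 - y)))
      (Real.pi ^ 2 / 6 * (y / (1 - y))) := by
    have h := (hasSum_nat_add_iff' (f := fun n : ℕ => (1 : ℝ) / (n : ℝ) ^ 2) 1).2 hasSum_zeta_two
    simpa using h.mul_right (y / (1 - y))
  refine hasSum_le (fun r => ?_) hs hz
  have hyr : y ^ (r + 1) < 1 := hlt r
  have hyr0 : 0 < y ^ (r + 1) := by positivity
  have hgeom : ∑ l ∈ Finset.range L, (y ^ (l + 1)) ^ (r + 1) ≤ y ^ (r + 1) / (1 - y ^ (r + 1)) := by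
    have e : ∀ l ∈ Finset.range L,
        (y ^ (l + 1)) ^ (r + 1) = y ^ (r + 1) * (y ^ (r + 1)) ^ l := fun l _ => by
      rw [← pow_mul, ← pow_mul, ← pow_add]; congr 1; ring
    rw [Finset.sum_congr rfl e, ← Finset.mul_sum, div_eq_mul_inv]
    refine mul_le_mul_of_nonneg_left ?_ hyr0.le
    rw [← tsum_geometric_of_lt_one hyr0.le hyr]
    exact (summable_geometric_of_lt_one hyr0.le hyr).sum_le_tsum _ fun _ _ => by positivity
  have hbern : ((r : ℝ) + 1) * y ^ r * (1 - y) ≤ 1 - y ^ (r + 1) := by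
    have e : (∑ i ∈ Finset.range (r + 1), y ^ i) * (1 - y) = 1 - y ^ (r + 1) := by
      linarith [geom_sum_mul y (r + 1)]
    rw [← e]
    refine mul_le_mul_of_nonneg_right ?_ (by linarith)
    have : ∑ i ∈ Finset.range (r + 1), y ^ r ≤ ∑ i ∈ Finset.range (r + 1), y ^ i :=
      Finset.sum_le_sum fun i hi =>
        pow_le_pow_of_le_one h0.le h1.le (by have := Finset.mem_range.1 hi; omega)
    simpa using this
  rw [← Finset.sum_div]
  have h1y : 0 < 1 - y := by linarith
  have h1r : 0 < 1 - y ^ (r + 1) := by linarith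
  calc (∑ l ∈ Finset.range L, (y ^ (l + 1)) ^ (r + 1)) / ((r : ℝ) + 1)
      ≤ y ^ (r + 1) / (1 - y ^ (r + 1)) / ((r : ℝ) + 1) := by gcongr
    _ ≤ 1 / ((r : ℝ) + 1) ^ 2 * (y / (1 - y)) := by
      rw [div_div, div_mul_div_comm, div_le_div_iff₀ (by positivity) (by positivity), pow_succ]
      have := mul_le_mul_of_nonneg_left hbern (show 0 ≤ ((r : ℝ) + 1) * y by positivity)
      rw [pow_succ] at this
      linarith

theorem exp_zeta_two_le : Real.exp (Real.pi ^ 2 / 6) ≤ 26 / 5 := by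
  have hpi : Real.pi ^ 2 / 6 ≤ 28 / 17 := by
    nlinarith [Real.pi_lt_d4, Real.pi_pos]
  refine (Real.exp_le_exp.2 hpi).trans ?_
  refine le_of_pow_le_pow_left₀ (n := 17) (by norm_num) (by norm_num) ?_
  rw [← Real.exp_nat_mul]
  have e : ((17 : ℕ) : ℝ) * (28 / 17) = (28 : ℕ) * 1 := by norm_num
  rw [e, Real.exp_nat_mul]
  calc Real.exp 1 ^ 28 ≤ 2.7182818286 ^ 28 :=
        pow_le_pow_left₀ (Real.exp_pos _).le Real.exp_one_lt_d9.le _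
    _ ≤ (26 / 5) ^ 17 := by norm_num

/-- Upper bound for the number of partitions into parts `≡ ±1 (mod m)` other than `m - 1`,
with a free parameter `v`. -/
theorem rho_QminusSet_le {m : ℕ} (hm : 2 ≤ m) {n K v : ℕ} (hv : 0 < v)
    (hn : 2 * n < (2 * m - 1) * (K + 1)) :
    (rho (QminusSet 1 m) n : ℝ) ≤ 2 / (v + 2) * (26 / 5) ^ v * ((v + 2) / v) ^ K := by
  have hv' : (0 : ℝ) < v := by exact_mod_cast hv
  set y : ℝ := v / (v + 2) with hy
  have h0 : 0 < y := by positivity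
  have h1y : 1 - y = 2 / (v + 2) := by rw [hy]; field_simp; ring
  have h1 : y < 1 := by
    have : 0 < 1 - y := by rw [h1y]; positivity
    linarith
  have hu : y / (1 - y) = v / 2 := by rw [h1y, hy]; field_simp
  have hmono : rho (QminusSet 1 m) n ≤ rho (pmParts m n) n := by
    refine rho_mono fun x hx hxn => mem_pmParts_of_mem_QminusSet hm hx ?_
    have := Nat.mul_le_mul_left (n + 2) hm
    omega
  have hb := weightBound_pmParts hm h0 h1 n K n hn
  have hprod := prod_inv_one_sub_pow_le h0 h1 (n + 1)
  have hexp : (∏ l ∈ Finset.range (n + 1), (1 - y ^ (l + 1))⁻¹) ^ 2 ≤ (26 / 5) ^ v := by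
    calc (∏ l ∈ Finset.range (n + 1), (1 - y ^ (l + 1))⁻¹) ^ 2
        ≤ Real.exp (Real.pi ^ 2 / 6 * (y / (1 - y))) ^ 2 := by
          refine pow_le_pow_left₀ (Finset.prod_nonneg fun l _ => inv_nonneg.2 ?_) hprod 2
          linarith [pow_le_one₀ (n := l + 1) h0.le h1.le]
      _ = Real.exp (Real.pi ^ 2 / 6) ^ v := by
          rw [← Real.exp_nat_mul, ← Real.exp_nat_mul, hu]
          congr 1
          push_cast
          ring
      _ ≤ (26 / 5) ^ v := pow_le_pow_left₀ (Real.exp_pos _).le exp_zeta_two_le v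
  have hinv : ((v + 2 : ℝ) / v) ^ K = (y ^ K)⁻¹ := by rw [hy, ← inv_pow, inv_div]
  rw [hinv, ← div_eq_mul_inv, le_div_iff₀ (by positivity), ← h1y]
  calc (rho (QminusSet 1 m) n : ℝ) * y ^ K ≤ rho (pmParts m n) n * y ^ K := by
        gcongr
    _ ≤ _ := hb
    _ ≤ _ := mul_le_mul_of_nonneg_left hexp (by linarith)

theorem one_le_qpart {a d n : ℕ} (ha : 0 < a) (hn : a ≤ n) : 1 ≤ qpart a d n := by
  unfold qpart
  have hne : n ≠ 0 := by omega
  have : Nonempty {p : n.Partition //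
    (∀ x ∈ p.parts, a ≤ x) ∧
    (∀ x ∈ p.parts, p.parts.count x ≤ 1) ∧
    (∀ x ∈ p.parts, ∀ y ∈ p.parts, x ≠ y → d ≤ max x y - min x y)} := by
    refine ⟨⟨⟨{n}, fun hi => ?_, Multiset.sum_singleton n⟩, ?_, ?_, ?_⟩⟩
    · rw [Multiset.mem_singleton] at hi; omega
    · intro x hx; rw [Multiset.mem_singleton] at hx; omega
    · intro x hx; rw [Multiset.mem_singleton] at hx; simp [hx]
    · intro x hx y hy hxy
      rw [Multiset.mem_singleton] at hx hy
      exact absurd (hx.trans hy.symm) hxy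
  exact Nat.card_pos

/-- Splitting according to whether `a` is a part. -/
theorem qpart_add_le {a d n : ℕ} (ha : 0 < a) (hd : 0 < d) (hn : a ≤ n) :
    qpart (a + 1) d n + qpart (a + d) d (n - a) ≤ qpart a d n := by
  unfold qpart
  rw [← Nat.card_sum]
  refine Nat.card_le_card_of_injective (Sum.elim
    (fun p => ⟨p.1, fun x hx => by have := p.2.1 x hx; omega, p.2.2⟩)
    (fun p => ⟨⟨a ::ₘ p.1.parts, fun {i} hi => ?_, ?_⟩, ?_, ?_, ?_⟩)) ?_
  · rcases Multiset.mem_cons.1 hi with rfl | h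
    · exact ha
    · exact p.1.parts_pos h
  · rw [Multiset.sum_cons, p.1.parts_sum]; omega
  · intro x hx
    rcases Multiset.mem_cons.1 hx with rfl | h
    · exact le_rfl
    · have := p.2.1 x h; omega
  · intro x hx
    rcases Multiset.mem_cons.1 hx with rfl | h
    · have : x ∉ p.1.parts := fun h => by have := p.2.1 x h; omega
      simp [Multiset.count_eq_zero_of_notMem this]
    · have hxa : x ≠ a := by have := p.2.1 x h; omega
      rw [Multiset.count_cons_of_ne hxa]
      exact p.2.2.1 x h
  · intro x hx y hy hxy
    rcases Multiset.mem_cons.1 hx with rfl | h <;> rcases Multiset.mem_cons.1 hy with rfl | h'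
    · exact absurd rfl hxy
    · have := p.2.1 y h'; omega
    · have := p.2.1 x h; omega
    · exact p.2.2.2 x h y h' hxy
  · rintro (p | p) (q | q) hpq <;>
      simp only [Sum.elim_inl, Sum.elim_inr, Subtype.mk.injEq, Nat.Partition.ext_iff] at hpq
    · exact congrArg Sum.inl (Subtype.ext (Nat.Partition.ext hpq))
    · have := p.2.1 a (hpq ▸ Multiset.mem_cons_self _ _)
      omega
    · have := q.2.1 a (hpq ▸ Multiset.mem_cons_self _ _)
      omega
    · exact congrArg Sum.inr (Subtype.ext (Nat.Partition.ext ((Multiset.cons_inj_right a).1 hpq)))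

theorem add_pow_succ_le (x h k : ℕ) :
    (x + h) ^ (k + 1) ≤ x ^ (k + 1) + (k + 1) * h * (x + h) ^ k := by
  induction k with
  | zero => simp
  | succ k ih =>
    calc (x + h) ^ (k + 1 + 1) = (x + h) ^ (k + 1) * x + (x + h) ^ (k + 1) * h := by ring
      _ ≤ (x ^ (k + 1) + (k + 1) * h * (x + h) ^ k) * x + (x + h) ^ (k + 1) * h := by gcongr
      _ = x ^ (k + 1 + 1) + (k + 1) * h * ((x + h) ^ k * x) + (x + h) ^ (k + 1) * h := by ring
      _ ≤ x ^ (k + 1 + 1) + (k + 1) * h * ((x + h) ^ k * (x + h)) + (x + h) ^ (k + 1) * h := by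
        gcongr; omega
      _ = _ := by ring

/-- Lower bound for `qpart` from the partitions with exactly `k + 1` parts. -/
theorem pow_le_qpart {d : ℕ} (hd : 0 < d) (k N a n : ℕ) (ha : 0 < a)
    (hn : 2 * ((k + 1) * a + N) + d * (k * (k + 1)) ≤ 2 * n) :
    N ^ k ≤ (k + 1).factorial * k.factorial * qpart a d n := by
  induction k generalizing N a n with
  | zero => simpa using one_le_qpart (d := d) ha (n := n) (by omega)
  | succ k ih =>
    induction N using Nat.strong_induction_on generalizing a with
    | _ N ihN =>
      have han : a ≤ n := by nlinarith [Nat.zero_le (d * ((k + 1) * (k + 1 + 1)))]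
      have hsplit := qpart_add_le ha hd han
      have h2 := ih N (a + d) (n - a) (by omega) (by
        obtain ⟨r, rfl⟩ := Nat.exists_eq_add_of_le han
        rw [Nat.add_sub_cancel_left]
        nlinarith)
      have hfac : (k + 1 + 1).factorial * (k + 1).factorial =
          (k + 2) * (k + 1) * ((k + 1).factorial * k.factorial) := by
        rw [Nat.factorial_succ (k + 1)]
        nth_rewrite 2 [Nat.factorial_succ k]
        ring
      have h2' : (k + 2) * (k + 1) * N ^ k ≤
          (k + 1 + 1).factorial * (k + 1).factorial * qpart (a + d) d (n - a) := by
        rw [hfac, mul_assoc ((k + 2) * (k + 1))]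
        exact Nat.mul_le_mul_left _ h2
      refine le_trans ?_ (Nat.mul_le_mul_left _ hsplit)
      rw [mul_add]
      rcases Nat.lt_or_ge N (k + 2) with hN | hN
      · calc N ^ (k + 1) = N * N ^ k := by ring
          _ ≤ (k + 2) * (k + 1) * N ^ k := by gcongr; nlinarith
          _ ≤ _ := h2'
          _ ≤ _ := Nat.le_add_left _ _
      · obtain ⟨M, rfl⟩ := Nat.exists_eq_add_of_le' hN
        have h1 := ihN M (by omega) (a + 1) (by omega) (by nlinarith)
        have h3 := add_pow_succ_le M (k + 2) k
        nlinarith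

theorem two_pow_mul_factorial_le (j : ℕ) : 2 ^ j * j.factorial ≤ (j + 1) ^ j := by
  induction j with
  | zero => simp
  | succ j ih =>
    have hb : 2 * (j + 1) ^ (j + 1) ≤ (j + 1 + 1) ^ (j + 1) := by
      have h := pow_add_mul_le_add_pow (a := j + 1) (b := 1) (by omega) (by omega) (j + 1)
      rw [Nat.add_sub_cancel, Nat.cast_id] at h
      linarith [pow_succ (j + 1) j]
    calc 2 ^ (j + 1) * (j + 1).factorial = 2 * (j + 1) * (2 ^ j * j.factorial) := by
          rw [Nat.factorial_succ]; ring
      _ ≤ 2 * (j + 1) * (j + 1) ^ j := by gcongr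
      _ = 2 * (j + 1) ^ (j + 1) := by ring
      _ ≤ _ := hb

theorem succ_mul_pow_le {j : ℕ} (hj : 7 ≤ j) :
    ((j : ℝ) + 1) * (77 / 2) ^ (j + 1) ≤ 2 * 204 ^ (j - 1) := by
  induction j, hj using Nat.le_induction with
  | base => norm_num
  | succ j hj ih =>
    have e : 204 ^ (j + 1 - 1) = (204 : ℝ) * 204 ^ (j - 1) := by
      rw [← pow_succ']; congr 1; omega
    have h7 : (7 : ℝ) ≤ j := by exact_mod_cast hj
    rw [e, pow_succ]
    push_cast
    have hp : (0 : ℝ) < (77 / 2) ^ (j + 1) := by positivity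
    nlinarith

theorem factorial_mul_pow_le {j : ℕ} (hj : 7 ≤ j) :
    ((j.factorial : ℝ) * (j - 1).factorial) * (77 / 2) ^ (j + 1) ≤
      (51 * (j * (j + 1))) ^ (j - 1) := by
  obtain ⟨i, rfl⟩ : ∃ i, j = i + 1 := ⟨j - 1, by omega⟩
  have h := succ_mul_pow_le hj
  simp only [Nat.add_sub_cancel] at h ⊢
  have hf1 : (2 : ℝ) ^ (i + 1) * (i + 1).factorial ≤ (i + 1 + 1) ^ (i + 1) := by
    exact_mod_cast two_pow_mul_factorial_le (i + 1)
  have hf2 : (2 : ℝ) ^ i * i.factorial ≤ (i + 1) ^ i := by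
    exact_mod_cast two_pow_mul_factorial_le i
  push_cast at h ⊢
  have hpos : (0 : ℝ) < 2 ^ (i + 1) * 2 ^ i := by positivity
  refine le_of_mul_le_mul_left ?_ hpos
  calc (2 : ℝ) ^ (i + 1) * 2 ^ i * ((i + 1).factorial * i.factorial * (77 / 2) ^ (i + 1 + 1))
      = (2 ^ (i + 1) * (i + 1).factorial) * (2 ^ i * i.factorial) * (77 / 2) ^ (i + 1 + 1) := by
        ring
    _ ≤ (i + 1 + 1) ^ (i + 1) * (i + 1) ^ i * (77 / 2) ^ (i + 1 + 1) := by gcongr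
    _ = (i + 1 + 1) ^ i * (i + 1) ^ i * ((i + 1 + 1) * (77 / 2) ^ (i + 1 + 1)) := by ring
    _ ≤ (i + 1 + 1) ^ i * (i + 1) ^ i * (2 * 204 ^ i) := by gcongr
    _ = 2 ^ (i + 1) * 2 ^ i * (51 * ((i + 1) * (i + 1 + 1))) ^ i := by
        have e : (204 : ℝ) = 2 * 2 * 51 := by norm_num
        rw [e]
        simp only [mul_pow]
        ring

theorem two_div_mul_pow_le {K v : ℕ} (hv : 0 < v) (hK : K ≤ v ^ 2) :
    (2 : ℝ) / (v + 2) * (26 / 5) ^ v * ((v + 2) / v) ^ K ≤ (77 / 2) ^ v := by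
  have hv' : (0 : ℝ) < v := by exact_mod_cast hv
  have hK' : (K : ℝ) ≤ v ^ 2 := by exact_mod_cast hK
  have h1 : ((v + 2 : ℝ) / v) ^ K ≤ (739 / 100) ^ v := by
    calc ((v + 2 : ℝ) / v) ^ K ≤ Real.exp (2 / v) ^ K := by
          refine pow_le_pow_left₀ (by positivity) ?_ K
          have : ((v + 2 : ℝ) / v) = 2 / v + 1 := by field_simp; ring
          rw [this]
          exact Real.add_one_le_exp _
      _ = Real.exp (K * (2 / v)) := (Real.exp_nat_mul _ _).symm
      _ ≤ Real.exp (v * 2) := by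
          refine Real.exp_le_exp.2 ?_
          rw [mul_div_assoc', div_le_iff₀ hv']
          nlinarith
      _ = Real.exp 2 ^ v := Real.exp_nat_mul _ _
      _ ≤ (739 / 100) ^ v := by
          refine pow_le_pow_left₀ (Real.exp_pos _).le ?_ v
          have e : (2 : ℝ) = 1 + 1 := by norm_num
          rw [e, Real.exp_add]
          nlinarith [Real.exp_one_lt_d9, Real.exp_pos 1]
  have h2 : (2 : ℝ) / (v + 2) ≤ 1 := by
    rw [div_le_one (by positivity)]; linarith
  calc (2 : ℝ) / (v + 2) * (26 / 5) ^ v * ((v + 2) / v) ^ K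
      ≤ 1 * (26 / 5) ^ v * (739 / 100) ^ v := by gcongr
    _ = (26 / 5 * (739 / 100)) ^ v := by rw [one_mul, mul_pow]
    _ ≤ (77 / 2) ^ v := by gcongr; norm_num

/-- Comparison of the two bounds, given admissible parameters: `v` for the upper bound on the
partitions into parts `≡ ±1`, and `k + 1` parts with slack `N` for the lower bound. -/
theorem rho_le_qpart_of_params {d n K : ℕ} (hd : 105 ≤ d) (hK : (2 * d - 3) * K ≤ 2 * n)
    (hK' : 2 * n < (2 * d - 3) * (K + 1)) (k v N : ℕ) (hv : 0 < v) (hkK : k * (k + 1) ≤ 2 * K)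
    (hN : 2 * (k + 1 + N) + 105 * (k * (k + 1)) ≤ 207 * K)
    (h : ((k + 1).factorial * k.factorial : ℝ) *
      (2 / (v + 2) * (26 / 5) ^ v * ((v + 2) / v) ^ K) ≤ N ^ k) :
    rho (QminusSet 1 (d - 1)) n ≤ qpart 1 d n := by
  have hup := rho_QminusSet_le (m := d - 1) (by omega) (n := n) (K := K) hv (by
    have : 2 * (d - 1) - 1 = 2 * d - 3 := by omega
    rwa [this])
  have hlow := pow_le_qpart (d := d) (by omega) k N 1 n one_pos (by
    obtain ⟨e, rfl⟩ := Nat.exists_eq_add_of_le hd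
    have e1 : 2 * (105 + e) - 3 = 207 + 2 * e := by omega
    rw [e1] at hK
    nlinarith [Nat.mul_le_mul_left e hkK])
  have hlow' : (N : ℝ) ^ k ≤ (k + 1).factorial * k.factorial * qpart 1 d n := by
    exact_mod_cast hlow
  have hpos : (0 : ℝ) < (k + 1).factorial * k.factorial := by positivity
  have := le_of_mul_le_mul_left ((mul_le_mul_of_nonneg_left hup hpos.le).trans (h.trans hlow')) hpos
  exact_mod_cast this

/-- As `rho_le_qpart_of_params`, with numerical conditions only at the ends of a range of `K`. -/
theorem rho_le_qpart_of_mem_range {d n K : ℕ} (hd : 105 ≤ d) (hK : (2 * d - 3) * K ≤ 2 * n)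
    (hK' : 2 * n < (2 * d - 3) * (K + 1)) (K₀ K₁ k v N : ℕ) (h0 : K₀ ≤ K) (h1 : K ≤ K₁)
    (hv : 0 < v) (hkK : k * (k + 1) ≤ 2 * K₀)
    (hN : 2 * (k + 1 + N) + 105 * (k * (k + 1)) ≤ 207 * K₀)
    (h : ((k + 1).factorial * k.factorial : ℝ) *
      (2 / (v + 2) * (26 / 5) ^ v * ((v + 2) / v) ^ K₁) ≤ N ^ k) :
    rho (QminusSet 1 (d - 1)) n ≤ qpart 1 d n := by
  refine rho_le_qpart_of_params hd hK hK' k v N hv (by omega) (by omega) (le_trans ?_ h)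
  have hv' : (0 : ℝ) < v := by exact_mod_cast hv
  have : (1 : ℝ) ≤ (v + 2) / v := by rw [one_le_div hv']; linarith
  gcongr

theorem rho_QminusSet_le_two {d n : ℕ} (hd : 105 ≤ d) (hn : n < 2 * d - 3) :
    rho (QminusSet 1 (d - 1)) n ≤ 2 := by
  have hpos : 0 < d - 1 + 1 := by omega
  have h0 : rho (QminusSet 1 (d - 1)) n ≤ rho (insert (d - 1 + 1) {1}) n :=
    rho_mono fun x hx hxn =>
      mem_pmParts_of_mem_QminusSet (L := 0) (by omega) hx (by omega)
  have h1 := rho_insert_le {1} hpos n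
  have h2 := rho_insert_le {1} hpos (n - (d - 1 + 1))
  have h3 := rho_singleton_one_le n
  have h4 := rho_singleton_one_le (n - (d - 1 + 1))
  rw [if_neg (by omega)] at h2
  split_ifs at h1 <;> omega

theorem two_le_qpart {d n : ℕ} (hd : 0 < d) (hn : d + 2 ≤ n) : 2 ≤ qpart 1 d n := by
  have h := qpart_add_le one_pos hd (show 1 ≤ n by omega)
  have h1 : 1 ≤ qpart (1 + 1) d n := one_le_qpart (by omega) (by omega)
  have h2 : 1 ≤ qpart (1 + d) d (n - 1) := one_le_qpart (by omega) (by omega)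
  omega

theorem stmt10 (d n : ℕ) (hd : 105 ≤ d) (hn : d + 2 ≤ n) :
    Qminus 1 (d - 4) n ≤ qpart 1 d n := by
  have hm : d - 4 + 3 = d - 1 := by omega
  rw [Qminus, hm]
  rcases Nat.lt_or_ge n (2 * d - 3) with hlt | hge
  · exact (rho_QminusSet_le_two hd hlt).trans (two_le_qpart (by omega) hn)
  obtain ⟨K, hK, hK'⟩ : ∃ K, (2 * d - 3) * K ≤ 2 * n ∧ 2 * n < (2 * d - 3) * (K + 1) :=
    ⟨2 * n / (2 * d - 3), Nat.mul_div_le _ _, Nat.lt_mul_div_succ _ (by omega)⟩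
  have hK2 : 2 ≤ K := by
    by_contra hlt
    have := Nat.mul_le_mul_left (2 * d - 3) (show K + 1 ≤ 2 by omega)
    omega
  have range := rho_le_qpart_of_mem_range hd hK hK'
  rcases Nat.lt_or_ge K 49 with hlt | h49
  · rcases Nat.lt_or_ge K 3 with h | h3
    · exact range 2 2 1 1 100 hK2 (by omega) (by omega) (by omega) (by omega)
        (by norm_num [Nat.factorial])
    rcases Nat.lt_or_ge K 4 with h | h4
    · exact range 3 3 1 1 203 h3 (by omega) (by omega) (by omega) (by omega)
        (by norm_num [Nat.factorial])
    rcases Nat.lt_or_ge K 6 with h | h6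
    · exact range 4 5 2 2 96 h4 (by omega) (by omega) (by omega) (by omega)
        (by norm_num [Nat.factorial])
    rcases Nat.lt_or_ge K 10 with h | h10
    · exact range 6 9 2 2 303 h6 (by omega) (by omega) (by omega) (by omega)
        (by norm_num [Nat.factorial])
    rcases Nat.lt_or_ge K 19 with h | h19
    · exact range 10 18 3 4 401 h10 (by omega) (by omega) (by omega) (by omega)
        (by norm_num [Nat.factorial])
    rcases Nat.lt_or_ge K 38 with h | h38
    · exact range 19 37 4 6 911 h19 (by omega) (by omega) (by omega) (by omega)
        (by norm_num [Nat.factorial])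
    · exact range 38 48 6 9 1721 h38 (by omega) (by omega) (by omega) (by omega)
        (by norm_num [Nat.factorial])
  · obtain ⟨k, hk⟩ : ∃ k, Nat.sqrt K = k + 1 :=
      ⟨Nat.sqrt K - 1, by have := Nat.sqrt_pos.2 (show 0 < K by omega); omega⟩
    have hk7 : 7 ≤ k + 1 := hk ▸ Nat.le_sqrt.2 h49
    have hlow : (k + 1) * (k + 1) ≤ K := hk ▸ Nat.sqrt_le K
    have hup : K < (k + 1 + 1) * (k + 1 + 1) := hk ▸ Nat.lt_succ_sqrt K
    refine rho_le_qpart_of_params hd hK hK' k (k + 2) (51 * ((k + 1) * (k + 2))) (by omega)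
      (by nlinarith) (by nlinarith) ?_
    have h1 := two_div_mul_pow_le (K := K) (v := k + 2) (by omega) (by nlinarith)
    have h2 := factorial_mul_pow_le hk7
    refine (mul_le_mul_of_nonneg_left h1 (by positivity)).trans ?_
    simp only [Nat.add_sub_cancel] at h2
    have e : (k : ℝ) + 1 + 1 = k + 2 := by ring
    push_cast at h2 ⊢
    rwa [e] at h2
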